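/- Let G = (V,E,w) be a weighted graph and let K ⊆ V be a nonempty subset. Let G_K be the complete graph on vertex set K with edge weights w_K(u,v) = d_G(u,v) for distinct u,v ∈ K, and let T_K be a minimum spanning tree of G_K. Then w_K(T_K) ≤ 2·w(MST(G)). -/

import Mathlib

open Finset

attribute [local instance] Classical.propDecidable

section Defs

variable {V : Type*} [Fintype V]

/-- Total weight of a (sub)graph: the sum of its edge weights. -/
noncomputable def wWeight (H : SimpleGraph V) (w : Sym2 V → ℝ) : ℝ :=
  ∑ e ∈ H.edgeSet.toFinite.toFinset, w e

/-- Shortest-path distance in a weighted graph: infimum of walk weights. -/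
noncomputable def wdist (G : SimpleGraph V) (w : Sym2 V → ℝ) (u v : V) : ℝ :=
  sInf {x : ℝ | ∃ p : G.Walk u v, x = (p.edges.map w).sum}

/-- `T` is a spanning tree of `G`. -/
def IsSpanningTree (G T : SimpleGraph V) : Prop :=
  T ≤ G ∧ T.IsTree

/-- Weight of a minimum spanning tree of `G`. -/
noncomputable def mstWeight (G : SimpleGraph V) (w : Sym2 V → ℝ) : ℝ :=
  sInf {x : ℝ | ∃ T : SimpleGraph V, IsSpanningTree G T ∧ x = wWeight T w}

/-- `T` is a minimum spanning tree of `G`. -/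
def IsMST (G : SimpleGraph V) (w : Sym2 V → ℝ) (T : SimpleGraph V) : Prop :=
  IsSpanningTree G T ∧ ∀ T' : SimpleGraph V, IsSpanningTree G T' → wWeight T w ≤ wWeight T' w

/-- A spanner of `G`: a connected spanning subgraph. -/
def IsSpanner (G H : SimpleGraph V) : Prop := H ≤ G ∧ H.Connected

/-- `G` together with `w` is a weighted graph: connected, positive pairwise-distinct
edge weights. -/
def IsWeightedGraph (G : SimpleGraph V) (w : Sym2 V → ℝ) : Prop :=
  G.Connected ∧ (∀ e ∈ G.edgeSet, 0 < w e) ∧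
    (∀ e ∈ G.edgeSet, ∀ e' ∈ G.edgeSet, e ≠ e' → w e ≠ w e')

/-- The ordered pairs of distinct vertices whose distortion in `H` is at most `t`. -/
noncomputable def goodPairs (G H : SimpleGraph V) (w : Sym2 V → ℝ) (t : ℝ) : Finset (V × V) :=
  Finset.univ.offDiag.filter (fun p => wdist H w p.1 p.2 ≤ t * wdist G w p.1 p.2)

/-- Scaling distortion `γ`: for every `ε ∈ (0,1)`, at least a `(1-ε)` fraction of the
pairs of distinct vertices have distortion at most `γ ε`.  (Counted over ordered pairs:
`n·(n-1) = 2·(n choose 2)`.) -/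
def HasScalingDistortion (G H : SimpleGraph V) (w : Sym2 V → ℝ) (γ : ℝ → ℝ) : Prop :=
  ∀ ε : ℝ, 0 < ε → ε < 1 →
    (1 - ε) * ((Fintype.card V : ℝ) * ((Fintype.card V : ℝ) - 1)) ≤
      ((goodPairs G H w (γ ε)).card : ℝ)

/-- The `ℓ_q`-distortion of the spanner `H` of `G`. -/
noncomputable def distq (G H : SimpleGraph V) (w : Sym2 V → ℝ) (q : ℝ) : ℝ :=
  ((∑ p ∈ (Finset.univ : Finset V).offDiag, (wdist H w p.1 p.2 / wdist G w p.1 p.2) ^ q) /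
    ((Fintype.card V : ℝ) * ((Fintype.card V : ℝ) - 1))) ^ (1 / q)

/-- `R(v,ε)`: the minimal radius `r` such that the ball `B(v,r)` contains at least `εn`
vertices. -/
noncomputable def Rgraph (G : SimpleGraph V) (w : Sym2 V → ℝ) (v : V) (ε : ℝ) : ℝ :=
  sInf {r : ℝ | 0 ≤ r ∧
    ε * (Fintype.card V : ℝ) ≤ ((Finset.univ.filter (fun u => wdist G w u v ≤ r)).card : ℝ)}

/-- Coarse scaling distortion `γ`: every pair of distinct vertices that are mutually
`ε/2`-far has distortion at most `γ ε`. -/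
def HasCoarseScalingDistortion (G H : SimpleGraph V) (w : Sym2 V → ℝ) (γ : ℝ → ℝ) : Prop :=
  ∀ ε : ℝ, 0 < ε → ε < 1 → ∀ u v : V, u ≠ v →
    Rgraph G w v (ε / 2) ≤ wdist G w u v → Rgraph G w u (ε / 2) ≤ wdist G w u v →
    wdist H w u v ≤ γ ε * wdist G w u v

end Defs

/-- Total weight of a walk, counting repeated edges with multiplicity. -/
noncomputable def walkWeight {V : Type*} {G : SimpleGraph V} (w : Sym2 V → ℝ) {u v : V}
    (p : G.Walk u v) : ℝ :=
  (p.edges.map w).sum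

lemma walkWeight_nonneg {V : Type*} {G : SimpleGraph V} {w : Sym2 V → ℝ}
    (hw : ∀ e ∈ G.edgeSet, 0 ≤ w e) {u v : V} (p : G.Walk u v) : 0 ≤ walkWeight w p := by
  refine List.sum_nonneg fun x hx => ?_
  obtain ⟨e, he, rfl⟩ := List.mem_map.1 hx
  exact hw e (p.edges_subset_edgeSet he)

section wdist

variable {V : Type*} {G : SimpleGraph V} {w : Sym2 V → ℝ}

lemma wdist_nonneg (hw : ∀ e ∈ G.edgeSet, 0 ≤ w e) (u v : V) : 0 ≤ wdist G w u v := by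
  refine Real.sInf_nonneg ?_
  rintro x ⟨p, rfl⟩
  exact walkWeight_nonneg hw p

lemma wdist_le_walkWeight (hw : ∀ e ∈ G.edgeSet, 0 ≤ w e) {u v : V} (p : G.Walk u v) :
    wdist G w u v ≤ walkWeight w p := by
  refine csInf_le ⟨0, ?_⟩ ⟨p, rfl⟩
  rintro x ⟨q, rfl⟩
  exact walkWeight_nonneg hw q

lemma wdist_le_add_of_adj (hG : G.Connected) (hw : ∀ e ∈ G.edgeSet, 0 ≤ w e) (k : V) {u v : V}
    (h : G.Adj u v) : wdist G w k v ≤ wdist G w k u + w s(u, v) := by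
  rw [← sub_le_iff_le_add]
  obtain ⟨q⟩ := hG.preconnected k u
  refine le_csInf ⟨_, q, rfl⟩ ?_
  rintro x ⟨p, rfl⟩
  rw [sub_le_iff_le_add]
  simpa [walkWeight, SimpleGraph.Walk.edges_concat] using wdist_le_walkWeight hw (p.concat h)

end wdist

/-- A walk in `G` yields a set of edges on `K`, of no larger total weight in the shortest-path
metric, that connects all the vertices of `K` the walk visits. -/
lemma exists_edges_reachable_of_walk {V : Type*} {G : SimpleGraph V}
    {w : Sym2 V → ℝ} (hG : G.Connected) (hw : ∀ e ∈ G.edgeSet, 0 ≤ w e) {K : Finset V}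
    {wK : Sym2 { x // x ∈ K } → ℝ}
    (hwK : ∀ u v : { x // x ∈ K }, wK s(u, v) = wdist G w u.1 v.1) {u v : V}
    (p : G.Walk u v) (k : { x // x ∈ K }) :
    ∃ F : Finset (Sym2 { x // x ∈ K }),
      ∑ e ∈ F, wK e ≤ wdist G w k.1 u + walkWeight w p ∧
      ∀ x : { x // x ∈ K }, x.1 ∈ p.support →
        (SimpleGraph.fromEdgeSet (F : Set (Sym2 { x // x ∈ K }))).Reachable k x := by
  have reach (F : Finset (Sym2 { x // x ∈ K })) (a b : { x // x ∈ K }) (h : s(a, b) ∈ F) :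
      (SimpleGraph.fromEdgeSet (F : Set (Sym2 { x // x ∈ K }))).Reachable a b := by
    by_cases hab : a = b
    · rw [hab]
    · exact SimpleGraph.Adj.reachable (by simp [h, hab])
  induction p generalizing k with
  | @nil u =>
    by_cases hu : u ∈ K
    · refine ⟨{s(k, ⟨u, hu⟩)}, by simp [hwK, walkWeight], fun x hx => ?_⟩
      obtain rfl : x = ⟨u, hu⟩ := Subtype.ext (by simpa using hx)
      exact reach _ _ _ (by simp)
    · refine ⟨∅, by simpa [walkWeight] using wdist_nonneg hw k.1 u, fun x hx => ?_⟩
      exact absurd x.2 (by simp_all)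
  | @cons u u' v h p ih =>
    have hcons : walkWeight w (p.cons h) = w s(u, u') + walkWeight w p := by simp [walkWeight]
    by_cases hu : u ∈ K
    · obtain ⟨F, hF, hr⟩ := ih ⟨u, hu⟩
      refine ⟨insert s(k, ⟨u, hu⟩) F, ?_, fun x hx => ?_⟩
      · have h1 : ∑ e ∈ insert s(k, ⟨u, hu⟩) F, wK e ≤ wK s(k, ⟨u, hu⟩) + ∑ e ∈ F, wK e := by
          by_cases hm : s(k, ⟨u, hu⟩) ∈ F
          · rw [Finset.insert_eq_of_mem hm, hwK]
            linarith [wdist_nonneg hw k.1 u]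
          · rw [Finset.sum_insert hm]
        have h2 : wdist G w u u' ≤ w s(u, u') := by
          simpa [walkWeight] using wdist_le_walkWeight hw h.toWalk
        rw [hwK] at h1
        dsimp only at h1 hF
        linarith
      · have h0 := reach (insert s(k, ⟨u, hu⟩) F) k ⟨u, hu⟩ (by simp)
        rw [SimpleGraph.Walk.support_cons, List.mem_cons] at hx
        rcases hx with hx | hx
        · obtain rfl : x = ⟨u, hu⟩ := Subtype.ext hx
          exact h0
        · exact h0.trans ((hr x hx).mono (SimpleGraph.fromEdgeSet_mono (by simp)))
    · obtain ⟨F, hF, hr⟩ := ih k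
      refine ⟨F, by linarith [wdist_le_add_of_adj hG hw k.1 h], fun x hx => hr x ?_⟩
      rw [SimpleGraph.Walk.support_cons, List.mem_cons] at hx
      exact hx.resolve_left fun hxu => hu (hxu ▸ x.2)

/-- A finite connected graph has a closed spanning walk whose weight is at most twice the weight
of the graph. -/
lemma exists_closed_walk_spanning {V : Type*} [Fintype V] {T : SimpleGraph V} {w : Sym2 V → ℝ}
    (hT : T.Connected) (hw : ∀ e ∈ T.edgeSet, 0 ≤ w e) (r : V) :
    ∃ p : T.Walk r r, (∀ x, x ∈ p.support) ∧ walkWeight w p ≤ 2 * wWeight T w := by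
  have key (n : ℕ) : n ≤ Fintype.card V → ∃ p : T.Walk r r, n ≤ p.support.toFinset.card ∧
      walkWeight w p ≤ 2 * ∑ e ∈ p.edges.toFinset, w e := by
    induction n with
    | zero => exact fun _ => ⟨.nil, by simp, by simp [walkWeight]⟩
    | succ n ih =>
      intro hn
      obtain ⟨p, hp, hpw⟩ := ih (by omega)
      by_cases hlt : n + 1 ≤ p.support.toFinset.card
      · exact ⟨p, hlt, hpw⟩
      obtain ⟨z, hz⟩ : ∃ z, z ∉ p.support := by
        by_contra! hall
        have : p.support.toFinset = Finset.univ := by ext; simp [hall]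
        rw [this, Finset.card_univ] at hlt
        exact hlt hn
      obtain ⟨q⟩ := hT.preconnected r z
      obtain ⟨d, -, hx, hy⟩ := q.exists_boundary_dart {x | x ∈ p.support} p.start_mem_support hz
      obtain ⟨⟨x, y⟩, hxy⟩ := d
      simp only [Set.mem_ofPred_eq] at hx hy
      let p' : T.Walk r r :=
        (p.takeUntil x hx).append (.cons hxy (.cons hxy.symm (p.dropUntil x hx)))
      have hspec := p.take_spec hx
      have hperm : p'.edges.Perm (s(x, y) :: s(x, y) :: p.edges) := by
        rw [← congrArg SimpleGraph.Walk.edges hspec]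
        simp only [p', SimpleGraph.Walk.edges_append, SimpleGraph.Walk.edges_cons,
          Sym2.eq_swap (a := y) (b := x)]
        exact List.perm_middle.trans (List.perm_middle.cons _)
      have hsupp : insert y p.support.toFinset ⊆ p'.support.toFinset := by
        intro a ha
        rw [Finset.mem_insert, List.mem_toFinset, ← hspec] at ha
        simp only [p', List.mem_toFinset, SimpleGraph.Walk.mem_support_append_iff,
          SimpleGraph.Walk.support_cons, List.mem_cons] at ha ⊢
        tauto
      have hnew : s(x, y) ∉ p.edges.toFinset := fun h =>
        hy (p.snd_mem_support_of_mem_edges (List.mem_toFinset.1 h))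
      refine ⟨p', ?_, ?_⟩
      · have h1 := Finset.card_le_card hsupp
        rw [Finset.card_insert_of_notMem (by simpa using hy)] at h1
        omega
      · have h1 : walkWeight w p' = w s(x, y) + (w s(x, y) + walkWeight w p) := by
          simpa [walkWeight] using (hperm.map w).sum_eq
        have h2 : p'.edges.toFinset = insert s(x, y) p.edges.toFinset := by
          rw [List.toFinset_eq_of_perm _ _ hperm]
          simp
        rw [h1, h2, Finset.sum_insert hnew]
        linarith
  obtain ⟨p, hp, hpw⟩ := key _ le_rfl
  refine ⟨p, fun x => ?_, hpw.trans ?_⟩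
  · have h := Finset.eq_univ_of_card _ (le_antisymm (Finset.card_le_univ _) hp)
    exact List.mem_toFinset.1 (h ▸ Finset.mem_univ x)
  · refine mul_le_mul_of_nonneg_left ?_ zero_le_two
    refine Finset.sum_le_sum_of_subset_of_nonneg (fun e he => ?_) fun e he _ => ?_
    · simpa using p.edges_subset_edgeSet (List.mem_toFinset.1 he)
    · exact hw e (by simpa using he)

/-- Let `G_K` be the complete graph on a nonempty `K ⊆ V` with edge
weights given by the shortest-path metric of `G`.  Then any minimum spanning tree `T_K`
of `G_K` has weight at most twice that of the MST of `G`. -/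
theorem stmt16 {V : Type} [Fintype V] (G : SimpleGraph V) (w : Sym2 V → ℝ)
    (hG : IsWeightedGraph G w) (K : Finset V) (hK : K.Nonempty)
    (wK : Sym2 { x // x ∈ K } → ℝ)
    (hwK : ∀ u v : { x // x ∈ K }, wK s(u, v) = wdist G w u.1 v.1)
    (TK : SimpleGraph { x // x ∈ K })
    (hTK : IsMST (⊤ : SimpleGraph { x // x ∈ K }) wK TK) :
    wWeight TK wK ≤ 2 * mstWeight G w := by
  obtain ⟨hconn, hpos, -⟩ := hG
  have hw : ∀ e ∈ G.edgeSet, 0 ≤ w e := fun e he => (hpos e he).le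
  have hwK0 (e : Sym2 { x // x ∈ K }) : 0 ≤ wK e := by
    induction e with
    | _ a b => exact hwK a b ▸ wdist_nonneg hw _ _
  obtain ⟨r, hr⟩ := hK
  rw [← div_le_iff₀' zero_lt_two]
  obtain ⟨T₀, hT₀, hT₀'⟩ := hconn.exists_isTree_le
  refine le_csInf ⟨_, T₀, ⟨hT₀, hT₀'⟩, rfl⟩ ?_
  rintro x ⟨T, ⟨hTG, hT⟩, rfl⟩
  rw [div_le_iff₀' zero_lt_two]
  obtain ⟨p, hp, hpw⟩ := exists_closed_walk_spanning hT.connected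
    (fun e he => hw e (SimpleGraph.edgeSet_mono hTG he)) r
  obtain ⟨F, hF, hreach⟩ :=
    exists_edges_reachable_of_walk hconn hw hwK (p.mapLe hTG) ⟨r, hr⟩
  have hFconn : (SimpleGraph.fromEdgeSet (F : Set (Sym2 { x // x ∈ K }))).Connected := by
    have h (a : { x // x ∈ K }) := hreach a (by simpa using hp a.1)
    exact { preconnected := fun a b => (h a).symm.trans (h b), nonempty := ⟨⟨r, hr⟩⟩ }
  obtain ⟨T', hT'le, hT'⟩ := hFconn.exists_isTree_le
  have hrr : wdist G w r r ≤ 0 := by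
    simpa [walkWeight] using wdist_le_walkWeight hw (SimpleGraph.Walk.nil : G.Walk r r)
  have hmap : walkWeight w (p.mapLe hTG) = walkWeight w p := by simp [walkWeight]
  have hsum : wWeight T' wK ≤ ∑ e ∈ F, wK e := by
    refine Finset.sum_le_sum_of_subset_of_nonneg (fun e he => ?_) fun e _ _ => hwK0 e
    have h := SimpleGraph.edgeSet_mono hT'le (by simpa using he)
    rw [SimpleGraph.edgeSet_fromEdgeSet] at h
    exact h.1
  have hmin := hTK.2 T' ⟨le_top, hT'⟩
  dsimp only at hF
  linarith
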